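/- Let f : (0,∞) → ℝ be continuously differentiable and non-decreasing, with the scale-invariance property: for every finite set R ⊂ ℝ and every s > 0, a matching M is an f(·)-minimal 1-colour matching of R if and only if sM is an f(·)-minimal 1-colour matching of sR. Suppose f'(1) > 0, and that there exists δ > 0 with 2f(1+δ) < f(2) + f(1) and f'(x) > 0 for all x ∈ [1, 1+δ]. Then f'(x) ≠ 0 for all x > 0. -/

import Mathlib

open Set

/-- The cost function `f_γ`. -/
noncomputable def fgam (γ x : ℝ) : ℝ :=
  if 0 < γ then x ^ γ else if γ = 0 then Real.log x else -(x ^ γ)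

variable {α : Type*} [MetricSpace α]

/-- The length of an unordered pair of points. -/
noncomputable def edgeLen : Sym2 α → ℝ :=
  Sym2.lift ⟨fun x y => dist x y, fun x y => dist_comm x y⟩

/-- `M` is a 1-colour (partial) matching of `R`. -/
def IsMatch1 (R : Set α) (M : Set (Sym2 α)) : Prop :=
  (∀ e ∈ M, ¬ e.IsDiag ∧ ∀ x ∈ e, x ∈ R) ∧
  (∀ e ∈ M, ∀ e' ∈ M, ∀ x : α, x ∈ e → x ∈ e' → e = e')

/-- `x` is matched in the 1-colour matching `M`. -/
def matched1 (M : Set (Sym2 α)) (x : α) : Prop := ∃ e ∈ M, x ∈ e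

/-- Number of unmatched points of `R` in `M`. -/
noncomputable def unm1 (R : Set α) (M : Set (Sym2 α)) : ℕ :=
  {x ∈ R | ¬ matched1 M x}.ncard

/-- The total cost of a 1-colour matching. -/
noncomputable def cost1 (f : ℝ → ℝ) (M : Set (Sym2 α)) : ℝ :=
  ∑ᶠ e ∈ M, f (edgeLen e)

/-- Lexicographic comparison of (number of unmatched points, cost). -/
def lexLe (u : ℕ) (c : ℝ) (u' : ℕ) (c' : ℝ) : Prop :=
  u < u' ∨ (u = u' ∧ c ≤ c')

/-- `M` is an `f`-minimal 1-colour matching of the finite set `R`. -/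
def FinMin1 (f : ℝ → ℝ) (R : Set α) (M : Set (Sym2 α)) : Prop :=
  IsMatch1 R M ∧
  ∀ m : Set (Sym2 α), IsMatch1 R m →
    lexLe (unm1 R M) (cost1 f M) (unm1 R m) (cost1 f m)

/-- `M` is a 2-colour (partial) matching of `R` and `B`. -/
def IsMatch2 (R B : Set α) (M : Set (α × α)) : Prop :=
  (∀ e ∈ M, e.1 ∈ R ∧ e.2 ∈ B) ∧
  (∀ x y y' : α, (x, y) ∈ M → (x, y') ∈ M → y = y') ∧
  (∀ x x' y : α, (x, y) ∈ M → (x', y) ∈ M → x = x')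

/-- Number of unmatched points in a 2-colour matching. -/
noncomputable def unm2 (R B : Set α) (M : Set (α × α)) : ℕ :=
  {x ∈ R | ¬ ∃ y, (x, y) ∈ M}.ncard + {y ∈ B | ¬ ∃ x, (x, y) ∈ M}.ncard

/-- The total cost of a 2-colour matching. -/
noncomputable def cost2 (f : ℝ → ℝ) (M : Set (α × α)) : ℝ :=
  ∑ᶠ e ∈ M, f (dist e.1 e.2)

/-- `M` is an `f`-minimal 2-colour matching of the finite sets `R`, `B`. -/
def FinMin2 (f : ℝ → ℝ) (R B : Set α) (M : Set (α × α)) : Prop :=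
  IsMatch2 R B M ∧
  ∀ m : Set (α × α), IsMatch2 R B m →
    lexLe (unm2 R B M) (cost2 f M) (unm2 R B m) (cost2 f m)

/-- `R'` is compatible with the 1-colour matching `M`. -/
def Compat1 (M : Set (Sym2 α)) (R' : Set α) : Prop :=
  ∀ e ∈ M, (∃ x ∈ e, x ∈ R') → ∀ y ∈ e, y ∈ R'

/-- Restriction of a 1-colour matching to a subset of points. -/
def restr1 (M : Set (Sym2 α)) (R' : Set α) : Set (Sym2 α) :=
  {e ∈ M | ∀ x ∈ e, x ∈ R'}

/-- `M` is an `f`-minimal 1-colour matching of a (possibly infinite) set `R`. -/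
def Min1 (f : ℝ → ℝ) (R : Set α) (M : Set (Sym2 α)) : Prop :=
  IsMatch1 R M ∧
  ∀ R' : Set α, R' ⊆ R → R'.Finite → Compat1 M R' → FinMin1 f R' (restr1 M R')

/-- `(R', B')` is compatible with the 2-colour matching `M`. -/
def Compat2 (M : Set (α × α)) (R' B' : Set α) : Prop :=
  ∀ e ∈ M, (e.1 ∈ R' ∨ e.2 ∈ B') → (e.1 ∈ R' ∧ e.2 ∈ B')

/-- Restriction of a 2-colour matching. -/
def restr2 (M : Set (α × α)) (R' B' : Set α) : Set (α × α) :=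
  {e ∈ M | e.1 ∈ R' ∧ e.2 ∈ B'}

/-- `M` is an `f`-minimal 2-colour matching of possibly infinite sets `R`, `B`. -/
def Min2 (f : ℝ → ℝ) (R B : Set α) (M : Set (α × α)) : Prop :=
  IsMatch2 R B M ∧
  ∀ R' B' : Set α, R' ⊆ R → B' ⊆ B → R'.Finite → B'.Finite →
    Compat2 M R' B' → FinMin2 f R' B' (restr2 M R' B')

open Classical in
noncomputable def lens1 (M : Set (Sym2 α)) : Multiset ℝ :=
  if h : M.Finite then h.toFinset.val.map edgeLen else 0

open Classical in
noncomputable def lens2 (M : Set (α × α)) : Multiset ℝ :=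
  if h : M.Finite then h.toFinset.val.map (fun e => dist e.1 e.2) else 0

/-- Increasing rearrangement of a multiset of reals, padded with `⊥ = -∞`. -/
noncomputable def incSeq (s : Multiset ℝ) : ℕ → EReal := fun n =>
  ((s.sort (· ≤ ·)).map (fun x : ℝ => (x : EReal))).getD n ⊥

/-- Decreasing rearrangement of a multiset of reals, padded with `⊥ = -∞`. -/
noncomputable def decSeq (s : Multiset ℝ) : ℕ → EReal := fun n =>
  ((s.sort (· ≤ ·)).reverse.map (fun x : ℝ => (x : EReal))).getD n ⊥

/-- Lexicographic (non-strict) comparison of sequences. -/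
def seqLex (a b : ℕ → EReal) : Prop :=
  a = b ∨ ∃ n : ℕ, (∀ m : ℕ, m < n → a m = b m) ∧ a n < b n

/-- Lexicographic comparison of (number of unmatched points, length sequence). -/
def lexSeqLe (u : ℕ) (a : ℕ → EReal) (u' : ℕ) (b : ℕ → EReal) : Prop :=
  u < u' ∨ (u = u' ∧ seqLex a b)

/-- `M` is a `(-∞)`-minimal 1-colour matching of the finite set `R`. -/
def FinNegMin1 (R : Set α) (M : Set (Sym2 α)) : Prop :=
  IsMatch1 R M ∧ ∀ m : Set (Sym2 α), IsMatch1 R m →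
    lexSeqLe (unm1 R M) (incSeq (lens1 M)) (unm1 R m) (incSeq (lens1 m))

/-- `M` is an `∞`-minimal 1-colour matching of the finite set `R`. -/
def FinPosMin1 (R : Set α) (M : Set (Sym2 α)) : Prop :=
  IsMatch1 R M ∧ ∀ m : Set (Sym2 α), IsMatch1 R m →
    lexSeqLe (unm1 R M) (decSeq (lens1 M)) (unm1 R m) (decSeq (lens1 m))

/-- `M` is a `(-∞)`-minimal 2-colour matching of the finite sets `R`, `B`. -/
def FinNegMin2 (R B : Set α) (M : Set (α × α)) : Prop :=
  IsMatch2 R B M ∧ ∀ m : Set (α × α), IsMatch2 R B m →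
    lexSeqLe (unm2 R B M) (incSeq (lens2 M)) (unm2 R B m) (incSeq (lens2 m))

/-- `M` is an `∞`-minimal 2-colour matching of the finite sets `R`, `B`. -/
def FinPosMin2 (R B : Set α) (M : Set (α × α)) : Prop :=
  IsMatch2 R B M ∧ ∀ m : Set (α × α), IsMatch2 R B m →
    lexSeqLe (unm2 R B M) (decSeq (lens2 M)) (unm2 R B m) (decSeq (lens2 m))

/-- `M` is a `(-∞)`-minimal 1-colour matching of a (possibly infinite) set `R`. -/
def NegMin1 (R : Set α) (M : Set (Sym2 α)) : Prop :=
  IsMatch1 R M ∧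
  ∀ R' : Set α, R' ⊆ R → R'.Finite → Compat1 M R' → FinNegMin1 R' (restr1 M R')

/-- `M` is a `(-∞)`-minimal 2-colour matching of possibly infinite `R`, `B`. -/
def NegMin2 (R B : Set α) (M : Set (α × α)) : Prop :=
  IsMatch2 R B M ∧
  ∀ R' B' : Set α, R' ⊆ R → B' ⊆ B → R'.Finite → B'.Finite →
    Compat2 M R' B' → FinNegMin2 R' B' (restr2 M R' B')

/-- `x` lies strictly between `a` and `b`. -/
def btw (a b x : ℝ) : Prop := min a b < x ∧ x < max a b

/-- The four reals are pairwise distinct. -/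
def distinct4 (a b c d : ℝ) : Prop :=
  a ≠ b ∧ a ≠ c ∧ a ≠ d ∧ b ≠ c ∧ b ≠ d ∧ c ≠ d

/-- The edges `{a,b}` and `{c,d}` are entwined. -/
def EntwinedP (a b c d : ℝ) : Prop :=
  distinct4 a b c d ∧ Xor' (btw a b c) (btw a b d)

/-- The edge `{a,b}` straddles the edge `{c,d}`. -/
def StraddleP (a b c d : ℝ) : Prop := btw a b c ∧ btw a b d

/-- `M` is a `(1+)`-minimal 1-colour matching of a finite set `R ⊂ ℝ`. -/
def OnePlusMin1 (R : Set ℝ) (M : Set (Sym2 ℝ)) : Prop :=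
  FinMin1 (fgam 1) R M ∧
  ∀ a b a' b' : ℝ, s(a, b) ∈ M → s(a', b') ∈ M → ¬ StraddleP a b a' b'

/-- `M` is a `(1-)`-minimal 1-colour matching of a finite set `R ⊂ ℝ`. -/
def OneMinusMin1 (R : Set ℝ) (M : Set (Sym2 ℝ)) : Prop :=
  FinMin1 (fgam 1) R M ∧
  ∀ a b a' b' : ℝ, s(a, b) ∈ M → s(a', b') ∈ M → ¬ EntwinedP a b a' b'

/-- `M` is a `(1+)`-minimal 2-colour matching of finite sets `R, B ⊂ ℝ`. -/
def OnePlusMin2 (R B : Set ℝ) (M : Set (ℝ × ℝ)) : Prop :=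
  FinMin2 (fgam 1) R B M ∧
  ∀ e ∈ M, ∀ e' ∈ M, ¬ StraddleP e.1 e.2 e'.1 e'.2

/-- `M` is a `(1-)`-minimal 2-colour matching of finite sets `R, B ⊂ ℝ`. -/
def OneMinusMin2 (R B : Set ℝ) (M : Set (ℝ × ℝ)) : Prop :=
  FinMin2 (fgam 1) R B M ∧
  ∀ e ∈ M, ∀ e' ∈ M, ¬ EntwinedP e.1 e.2 e'.1 e'.2


/-- The image of a 1-colour matching of reals under scaling by `s`. -/
def scaleM (s : ℝ) (M : Set (Sym2 ℝ)) : Set (Sym2 ℝ) := (Sym2.map fun x => s * x) '' M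

/-- `f` has the scale-invariance property: for every finite `R ⊂ ℝ` and `s > 0`,
`M` is `f`-minimal for `R` iff `sM` is `f`-minimal for `sR`. -/
def ScaleInv (f : ℝ → ℝ) : Prop :=
  ∀ R : Set ℝ, R.Finite → ∀ s : ℝ, 0 < s → ∀ M : Set (Sym2 ℝ),
    (FinMin1 f R M ↔ FinMin1 f ((fun x => s * x) '' R) (scaleM s M))

lemma aux_count (R : Set ℝ) (hR : R.Finite) (m : Set (Sym2 ℝ)) (hm : IsMatch1 R m) :
    m.Finite ∧ unm1 R m + 2 * m.ncard = R.ncard := by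
  classical
  have hfin : m.Finite := by
    apply Set.Finite.subset (hR.toFinset.sym2.finite_toSet)
    intro e he
    simp only [Finset.mem_coe, Finset.mem_sym2_iff, Set.Finite.mem_toFinset]
    exact (hm.1 e he).2
  refine ⟨hfin, ?_⟩
  have h1 : {x ∈ R | matched1 m x} = ((hfin.toFinset.biUnion Sym2.toFinset : Finset ℝ) : Set ℝ) := by
    ext x
    simp only [Set.mem_setOf_eq, Finset.coe_biUnion, Set.mem_iUnion, Finset.mem_coe,
      Set.Finite.mem_toFinset, Sym2.mem_toFinset, matched1, exists_prop]
    constructor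
    · exact fun h => h.2
    · rintro ⟨e, he, hx⟩
      exact ⟨(hm.1 e he).2 x hx, e, he, hx⟩
  have h2 : {x ∈ R | matched1 m x}.ncard = 2 * m.ncard := by
    rw [h1, Set.ncard_coe_finset, Finset.card_biUnion]
    · rw [Finset.sum_const_nat (m := 2)]
      · rw [← Set.ncard_eq_toFinset_card m hfin, mul_comm]
      · intro e he
        exact Sym2.card_toFinset_of_not_isDiag e (hm.1 e (by simpa using he)).1
    · intro e he e' he' hne
      rw [Function.onFun, Finset.disjoint_left]
      intro x hx hx'
      rw [Sym2.mem_toFinset] at hx hx'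
      exact hne (hm.2 e (by simpa using he) e' (by simpa using he') x hx hx')
  rw [← h2, unm1, add_comm, ← Set.ncard_union_eq ?_ (hR.subset (fun x hx => hx.1)) (hR.subset (fun x hx => hx.1))]
  · congr 1
    ext x
    simp only [Set.mem_union, Set.mem_setOf_eq]
    tauto
  · rw [Set.disjoint_left]
    intro x hx hx'
    exact hx'.2 hx.2

lemma aux_pair (R : Set ℝ) {x y z w : ℝ} (hx : x ∈ R) (hy : y ∈ R) (hz : z ∈ R) (hw : w ∈ R)
    (hxy : x ≠ y) (hxz : x ≠ z) (hxw : x ≠ w) (hyz : y ≠ z) (hyw : y ≠ w) (hzw : z ≠ w) :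
    IsMatch1 R {s(x, y), s(z, w)} := by
  constructor
  · rintro e (rfl | rfl)
    · refine ⟨by simpa using hxy, ?_⟩
      intro t ht
      rcases Sym2.mem_iff.1 ht with rfl | rfl <;> assumption
    · refine ⟨by simpa using hzw, ?_⟩
      intro t ht
      rcases Sym2.mem_iff.1 ht with rfl | rfl <;> assumption
  · rintro e (rfl | rfl) e' (rfl | rfl) t ht ht'
    · rfl
    · exfalso
      rw [Sym2.mem_iff] at ht ht'
      grind
    · exfalso
      rw [Sym2.mem_iff] at ht ht'
      grind
    · rfl

lemma aux_cost (f : ℝ → ℝ) {x y z w : ℝ} (h : s(x, y) ≠ s(z, w)) :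
    cost1 f {s(x, y), s(z, w)} = f |x - y| + f |z - w| := by
  rw [cost1, finsum_mem_pair h]
  rfl

lemma aux_unm (R : Set ℝ) (h5 : R.ncard = 5) {m : Set (Sym2 ℝ)} (hm : IsMatch1 R m)
    {e e' : Sym2 ℝ} (he : e ≠ e') (hme : m = {e, e'}) : unm1 R m = 1 := by
  have hR : R.Finite := Set.finite_of_ncard_pos (by omega)
  have h := (aux_count R hR m hm).2
  rw [hme, Set.ncard_pair he, ← hme, h5] at h
  omega

lemma aux_min (f : ℝ → ℝ) (R : Set ℝ) (h5 : R.ncard = 5) {x y z w : ℝ}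
    (hx : x ∈ R) (hy : y ∈ R) (hz : z ∈ R) (hw : w ∈ R)
    (hxy : x ≠ y) (hxz : x ≠ z) (hxw : x ≠ w) (hyz : y ≠ z) (hyw : y ≠ w) (hzw : z ≠ w)
    (H : ∀ x' ∈ R, ∀ y' ∈ R, ∀ z' ∈ R, ∀ w' ∈ R, x' ≠ y' → x' ≠ z' → x' ≠ w' → y' ≠ z' →
      y' ≠ w' → z' ≠ w' → f |x - y| + f |z - w| ≤ f |x' - y'| + f |z' - w'|) :
    FinMin1 f R {s(x, y), s(z, w)} := by
  have hR : R.Finite := Set.finite_of_ncard_pos (by omega)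
  have hM := aux_pair R hx hy hz hw hxy hxz hxw hyz hyw hzw
  have hne : s(x, y) ≠ s(z, w) := by
    intro h
    rw [Sym2.eq_iff] at h
    tauto
  refine ⟨hM, fun m hm => ?_⟩
  rw [aux_unm R h5 hM hne rfl, aux_cost f hne]
  obtain ⟨-, hc⟩ := aux_count R hR m hm
  rw [h5] at hc
  by_cases h1 : unm1 R m = 1
  · right
    refine ⟨h1.symm, ?_⟩
    obtain ⟨e, e', hee, rfl⟩ := Set.ncard_eq_two.1 (show m.ncard = 2 by omega)
    induction e with | _ x' y'
    induction e' with | _ z' w'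
    rw [aux_cost f hee]
    have a1 := hm.1 s(x', y') (by simp)
    have a2 := hm.1 s(z', w') (by simp)
    have a3 := hm.2 s(x', y') (by simp) s(z', w') (by simp)
    have key : ∀ t, t ∈ s(x', y') → t ∈ s(z', w') → False := fun t h h' => hee (a3 t h h')
    refine H x' (a1.2 _ (by simp)) y' (a1.2 _ (by simp)) z' (a2.2 _ (by simp)) w'
      (a2.2 _ (by simp)) (by simpa using a1.1) ?_ ?_ ?_ ?_ (by simpa using a2.1)
    · rintro rfl; exact key x' (by simp) (by simp)
    · rintro rfl; exact key x' (by simp) (by simp)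
    · rintro rfl; exact key y' (by simp) (by simp)
    · rintro rfl; exact key y' (by simp) (by simp)
  · left
    omega

lemma aux_enum : ∀ i j k l : Fin 5, i < j → k < l → i < k → j ≠ k → j ≠ l →
    (i, j, k, l) ∈ [((0 : Fin 5), (1 : Fin 5), (2 : Fin 5), (3 : Fin 5)), (0,1,2,4), (0,1,3,4),
      (0,2,1,3), (0,2,1,4), (0,2,3,4), (0,3,1,2), (0,3,1,4), (0,3,2,4), (0,4,1,2), (0,4,1,3),
      (0,4,2,3), (1,2,3,4), (1,3,2,4), (1,4,2,3)] := by
  decide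

lemma aux_key (f : ℝ → ℝ) (hmono : MonotoneOn f (Set.Ioi 0)) (hscale : ScaleInv f)
    {a b c d s : ℝ} (hb : 0 < b) (hba : b ≤ a) (hc : 0 < c) (hcd : c ≤ d)
    (hd : d ≤ a + b + c) (ha : a ≤ b + c + d) (hs : 0 < s)
    (hle : f a + f c ≤ f b + f d) : f (s * a) + f (s * c) ≤ f (s * b) + f (s * d) := by
  have ha0 : 0 < a := by linarith
  have hd0 : 0 < d := by linarith
  have hK : ∀ u v, ((a ≤ u ∧ c ≤ v) ∨ (c ≤ u ∧ a ≤ v) ∨ (b ≤ u ∧ d ≤ v) ∨ (d ≤ u ∧ b ≤ v)) →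
      f a + f c ≤ f u + f v := by
    have hm : ∀ p q, 0 < p → p ≤ q → f p ≤ f q := fun p q hp hpq =>
      hmono hp (lt_of_lt_of_le hp hpq) hpq
    rintro u v (⟨h, h'⟩ | ⟨h, h'⟩ | ⟨h, h'⟩ | ⟨h, h'⟩)
    · linarith [hm _ _ ha0 h, hm _ _ hc h']
    · linarith [hm _ _ ha0 h', hm _ _ hc h]
    · linarith [hm _ _ hb h, hm _ _ hd0 h']
    · linarith [hm _ _ hb h', hm _ _ hd0 h]
  let p : Fin 5 → ℝ := ![0, a, a + b, a + b + c, a + b + c + d]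
  have p0 : p 0 = 0 := rfl
  have p1 : p 1 = a := rfl
  have p2 : p 2 = a + b := rfl
  have p3 : p 3 = a + b + c := rfl
  have p4 : p 4 = a + b + c + d := rfl
  have hp : StrictMono p := by
    rw [Fin.strictMono_iff_lt_succ]
    intro i
    fin_cases i
    · change p 0 < p 1; linarith
    · change p 1 < p 2; linarith
    · change p 2 < p 3; linarith
    · change p 3 < p 4; linarith
  clear_value p
  have h5 : (Set.range p).ncard = 5 := by
    rw [Set.ncard_range_of_injective hp.injective]; simp
  have hord : ∀ i j k l : Fin 5, i < j → k < l → i < k → j ≠ k → j ≠ l →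
      f a + f c ≤ f |p i - p j| + f |p k - p l| := by
    intro i j k l h1 h2 h3 h4 h5
    have h := aux_enum i j k l h1 h2 h3 h4 h5
    rw [abs_sub_comm (p i), abs_sub_comm (p k), abs_of_pos (sub_pos.2 (hp h1)),
      abs_of_pos (sub_pos.2 (hp h2))]
    apply hK
    simp only [List.mem_cons, Prod.mk.injEq, List.not_mem_nil, or_false] at h
    rcases h with h | h | h | h | h | h | h | h | h | h | h | h | h | h | h <;>
      (obtain ⟨rfl, rfl, rfl, rfl⟩ := h
       simp only [p0, p1, p2, p3, p4]
       first
        | (left; constructor <;> linarith)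
        | (right; left; constructor <;> linarith)
        | (right; right; left; constructor <;> linarith)
        | (right; right; right; constructor <;> linarith))
  have hord2 : ∀ i j k l : Fin 5, i < j → k < l → i ≠ k → i ≠ l → j ≠ k → j ≠ l →
      f a + f c ≤ f |p i - p j| + f |p k - p l| := by
    intro i j k l h1 h2 h3 h4 h5 h6
    rcases lt_or_gt_of_ne h3 with h | h
    · exact hord i j k l h1 h2 h h5 h6
    · rw [add_comm (f |p i - p j|)]
      exact hord k l i j h2 h1 h h4.symm h6.symm
  have hord3 : ∀ i j k l : Fin 5, i ≠ j → k < l → i ≠ k → i ≠ l → j ≠ k → j ≠ l →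
      f a + f c ≤ f |p i - p j| + f |p k - p l| := by
    intro i j k l h1 h2 h3 h4 h5 h6
    rcases lt_or_gt_of_ne h1 with h | h
    · exact hord2 i j k l h h2 h3 h4 h5 h6
    · rw [abs_sub_comm (p i)]
      exact hord2 j i k l h h2 h5 h6 h3 h4
  have hord4 : ∀ i j k l : Fin 5, i ≠ j → k ≠ l → i ≠ k → i ≠ l → j ≠ k → j ≠ l →
      f a + f c ≤ f |p i - p j| + f |p k - p l| := by
    intro i j k l h1 h2 h3 h4 h5 h6
    rcases lt_or_gt_of_ne h2 with h | h
    · exact hord3 i j k l h1 h h3 h4 h5 h6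
    · rw [abs_sub_comm (p k)]
      exact hord3 i j l k h1 h h4 h3 h6 h5
  have ne : ∀ i j : Fin 5, i ≠ j → p i ≠ p j := fun i j h => hp.injective.ne h
  have hmin : FinMin1 f (Set.range p) {s(p 0, p 1), s(p 2, p 3)} := by
    refine aux_min f _ h5 ⟨_, rfl⟩ ⟨_, rfl⟩ ⟨_, rfl⟩ ⟨_, rfl⟩ (ne _ _ (by decide))
      (ne _ _ (by decide)) (ne _ _ (by decide)) (ne _ _ (by decide)) (ne _ _ (by decide))
      (ne _ _ (by decide)) ?_
    rintro _ ⟨i, rfl⟩ _ ⟨j, rfl⟩ _ ⟨k, rfl⟩ _ ⟨l, rfl⟩ h1 h2 h3 h4 h5 h6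
    have e1 : |p 0 - p 1| = a := by
      rw [abs_sub_comm, abs_of_pos] <;> linarith
    have e2 : |p 2 - p 3| = c := by
      rw [abs_sub_comm, abs_of_pos] <;> linarith
    rw [e1, e2]
    exact hord4 i j k l (fun h => h1 (by rw [h])) (fun h => h6 (by rw [h]))
      (fun h => h2 (by rw [h])) (fun h => h3 (by rw [h])) (fun h => h4 (by rw [h]))
      (fun h => h5 (by rw [h]))
  have hsc := (hscale _ (Set.finite_range p) s hs _).1 hmin
  have hsM : scaleM s {s(p 0, p 1), s(p 2, p 3)} = {s(s * p 0, s * p 1), s(s * p 2, s * p 3)} := by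
    rw [scaleM, Set.image_pair]; rfl
  rw [hsM] at hsc
  set R' := (fun x => s * x) '' Set.range p with hR'
  have hinj : Function.Injective (fun x : ℝ => s * x) := mul_right_injective₀ hs.ne'
  have h5' : R'.ncard = 5 := by
    rw [hR', Set.ncard_image_of_injective _ hinj, h5]
  have mem : ∀ i, s * p i ∈ R' := fun i => ⟨p i, ⟨i, rfl⟩, rfl⟩
  have ne' : ∀ i j : Fin 5, i ≠ j → s * p i ≠ s * p j := fun i j h => hinj.ne (ne i j h)
  have hm2 : IsMatch1 R' {s(s * p 1, s * p 2), s(s * p 3, s * p 4)} :=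
    aux_pair R' (mem _) (mem _) (mem _) (mem _) (ne' _ _ (by decide))
      (ne' _ _ (by decide)) (ne' _ _ (by decide)) (ne' _ _ (by decide)) (ne' _ _ (by decide))
      (ne' _ _ (by decide))
  have hne1 : s(s * p 0, s * p 1) ≠ s(s * p 2, s * p 3) := by
    intro h
    rw [Sym2.eq_iff] at h
    rcases h with h | h
    · exact ne' 0 2 (by decide) h.1
    · exact ne' 0 3 (by decide) h.1
  have hne2 : s(s * p 1, s * p 2) ≠ s(s * p 3, s * p 4) := by
    intro h
    rw [Sym2.eq_iff] at h
    rcases h with h | h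
    · exact ne' 1 3 (by decide) h.1
    · exact ne' 1 4 (by decide) h.1
  have hfinal := hsc.2 _ hm2
  rw [aux_unm R' h5' hsc.1 hne1 rfl, aux_unm R' h5' hm2 hne2 rfl, aux_cost f hne1,
    aux_cost f hne2] at hfinal
  rcases hfinal with h | ⟨-, h⟩
  · omega
  · have hab : ∀ i j : Fin 5, ∀ t, 0 < t → p j - p i = t → |s * p i - s * p j| = s * t := by
      intro i j t ht hij
      rw [abs_sub_comm, ← mul_sub, hij, abs_of_pos (mul_pos hs ht)]
    rwa [hab 0 1 a ha0 (by linarith), hab 2 3 c hc (by linarith), hab 1 2 b hb (by linarith),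
      hab 3 4 d hd0 (by linarith)] at h

lemma aux_deriv {φ : ℝ → ℝ} {φ' : ℝ} (h : HasDerivAt φ φ' 0) (h0 : φ 0 = 0) (hpos : 0 < φ') :
    ∀ᶠ t in nhdsWithin (0 : ℝ) (Set.Ioi 0), 0 < φ t := by
  have h1 := h.tendsto_slope_zero
  have h2 := h1.eventually (lt_mem_nhds hpos)
  have h3 : ∀ᶠ t in nhdsWithin (0 : ℝ) (Set.Ioi 0), 0 < t⁻¹ • (φ (0 + t) - φ 0) :=
    h2.filter_mono (nhdsWithin_mono _ (fun t (ht : 0 < t) => ht.ne'))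
  filter_upwards [h3, self_mem_nhdsWithin] with t ht ht0
  rw [zero_add, h0, sub_zero, smul_eq_mul] at ht
  exact (pos_iff_pos_of_mul_pos ht).1 (inv_pos.2 ht0)

/-- Under the hypotheses of the scale-invariance proposition, the derivative of `f`
never vanishes on `(0,∞)`. -/
theorem stmt_10 (f f' : ℝ → ℝ)
    (hderiv : ∀ x ∈ Set.Ioi (0 : ℝ), HasDerivAt f (f' x) x)
    (hcont : ContinuousOn f' (Set.Ioi 0))
    (hmono : MonotoneOn f (Set.Ioi 0))
    (hscale : ScaleInv f)
    (h1 : 0 < f' 1)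
    (hδ : ∃ δ : ℝ, 0 < δ ∧ 2 * f (1 + δ) < f 2 + f 1 ∧
      ∀ x ∈ Set.Icc (1 : ℝ) (1 + δ), 0 < f' x) :
    ∀ x : ℝ, 0 < x → f' x ≠ 0 := by
  intro x hx hfx
  have hq : 0 < x⁻¹ := inv_pos.2 hx
  have hlin : ∀ u k : ℝ, 0 < u → HasDerivAt (fun t => f (u + k * t)) (f' u * k) 0 := by
    intro u k hu
    have hin : HasDerivAt (fun t : ℝ => u + k * t) k 0 := by
      simpa using ((hasDerivAt_id (0 : ℝ)).const_mul k).const_add u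
    have hout : HasDerivAt f (f' u) ((fun t : ℝ => u + k * t) 0) := by
      simpa using hderiv u hu
    exact hout.comp 0 hin
  obtain ⟨C, hC, hC2⟩ : ∃ C : ℝ, 0 < C ∧ f' x⁻¹ < C * f' 1 := by
    refine ⟨(|f' x⁻¹| + 1) / f' 1, by positivity, ?_⟩
    rw [div_mul_cancel₀ _ h1.ne']
    linarith [le_abs_self (f' x⁻¹)]
  have d1 := (hlin 1 1 one_pos).sub (hlin x C hx)
  have d2 := (hlin 1 (x⁻¹ * C) one_pos).sub (hlin x⁻¹ x⁻¹ hq)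
  have e1 := aux_deriv (d1.sub_const (f 1 - f x)) (by simp) (by rw [hfx]; simpa using h1)
  have e2 := aux_deriv (d2.sub_const (f 1 - f x⁻¹)) (by simp) (by nlinarith)
  have e3 : ∀ᶠ t in nhdsWithin (0 : ℝ) (Set.Ioi 0), t < x :=
    (gt_mem_nhds hx).filter_mono nhdsWithin_le_nhds
  have e4 : ∀ᶠ t in nhdsWithin (0 : ℝ) (Set.Ioi 0), t < 1 / C :=
    (gt_mem_nhds (by positivity)).filter_mono nhdsWithin_le_nhds
  obtain ⟨t, t1, t2, t3, t4, t5⟩ :=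
    (e1.and (e2.and (e3.and (e4.and self_mem_nhdsWithin)))).exists
  have t5' : 0 < t := t5
  have hCt : 0 < C * t := by positivity
  rw [lt_div_iff₀ hC] at t4
  simp only [Pi.sub_apply, one_mul] at t1 t2
  have := aux_key f hmono hscale (a := x + C * t) (b := x) (c := 1) (d := 1 + t) (s := x⁻¹)
    hx (by linarith) one_pos (by linarith) (by linarith) (by nlinarith) hq (by linarith)
  have r1 : x⁻¹ * (x + C * t) = 1 + x⁻¹ * C * t := by field_simp
  have r2 : x⁻¹ * x = 1 := inv_mul_cancel₀ hx.ne'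
  rw [r1, r2, mul_add, mul_one] at this
  linarith
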